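/- arXiv:1409.4076 — 3 statements merged into one kernel-verified Lean document; each statement's English description precedes it below -/
import Mathlib

section
/- Let $p\ge 2$, $0<\alpha<n/p$, and $\sigma$ a nonnegative locally finite Borel measure on $\mathbb{R}^n$. Then for all $x\in\mathbb{R}^n$ and $R>0$, the average $\frac{1}{|B(x,R)|}\int_{B(x,R)}\mathbf{W}_{\alpha,p}\sigma(y)\,dy \le c\int_R^\infty (\sigma(B(x,r))/r^{n-\alpha p})^{1/(p-1)}\,dr/r$, where $c$ depends only on $n,p,\alpha$. -/
open MeasureTheory ENNReal

noncomputable def wolffTail (n : ℕ) (p α : ℝ)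
    (σ : Measure (EuclideanSpace ℝ (Fin n))) (x : EuclideanSpace ℝ (Fin n)) (R : ℝ) : ℝ≥0∞ :=
  ∫⁻ r in Set.Ioi R,
    (σ (Metric.ball x r) / ENNReal.ofReal (r ^ ((n : ℝ) - α * p))) ^ (1 / (p - 1))
      / ENNReal.ofReal r

noncomputable def wolff (n : ℕ) (p α : ℝ)
    (σ : Measure (EuclideanSpace ℝ (Fin n))) (x : EuclideanSpace ℝ (Fin n)) : ℝ≥0∞ :=
  wolffTail n p α σ x 0

lemma wolff_aux_meas {n : ℕ} (σ : Measure (EuclideanSpace ℝ (Fin n))) [SFinite σ] :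
    Measurable (fun z : EuclideanSpace ℝ (Fin n) × ℝ => σ (Metric.ball z.1 z.2)) := by
  have ho : IsOpen {w : (EuclideanSpace ℝ (Fin n) × ℝ) × EuclideanSpace ℝ (Fin n) |
      dist w.2 w.1.1 < w.1.2} := isOpen_lt (by fun_prop) (by fun_prop)
  exact measurable_measure_prodMk_left (ν := σ) ho.measurableSet

lemma wolff_aux_integrand_meas {n : ℕ} (q m : ℝ)
    (σ : Measure (EuclideanSpace ℝ (Fin n))) [SFinite σ] :
    Measurable (fun z : EuclideanSpace ℝ (Fin n) × ℝ =>
      (σ (Metric.ball z.1 z.2) / ENNReal.ofReal (z.2 ^ m)) ^ q / ENNReal.ofReal z.2) := by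
  have h := wolff_aux_meas σ
  have h2 : Measurable (fun z : EuclideanSpace ℝ (Fin n) × ℝ => ENNReal.ofReal (z.2 ^ m)) := by
    fun_prop
  have h3 : Measurable (fun z : EuclideanSpace ℝ (Fin n) × ℝ => ENNReal.ofReal z.2) := by
    fun_prop
  exact ((h.div h2).pow_const q).div h3

lemma wolff_aux_fubini {n : ℕ} (σ : Measure (EuclideanSpace ℝ (Fin n))) [SFinite σ]
    (x : EuclideanSpace ℝ (Fin n)) (R r : ℝ) (hr : 0 < r) (hrR : r ≤ R) :
    (volume (Metric.ball x R))⁻¹ * ∫⁻ y in Metric.ball x R, σ (Metric.ball y r)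
      ≤ ENNReal.ofReal ((r / R) ^ (n : ℝ)) * σ (Metric.ball x (2 * R)) := by
  have hR : 0 < R := hr.trans_le hrR
  have ho : IsOpen {w : EuclideanSpace ℝ (Fin n) × EuclideanSpace ℝ (Fin n) |
      dist w.2 w.1 < r} := isOpen_lt (by fun_prop) (by fun_prop)
  have h1 : ∫⁻ y in Metric.ball x R, σ (Metric.ball y r)
      ≤ volume (Metric.ball x r) * σ (Metric.ball x (2 * R)) := by
    have e1 : ∀ y ∈ Metric.ball x R, σ (Metric.ball y r) ≤
        (σ.restrict (Metric.ball x (2 * R))) (Metric.ball y r) := by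
      intro y hy
      rw [Measure.restrict_apply Metric.isOpen_ball.measurableSet]
      refine measure_mono (Set.subset_inter subset_rfl (Metric.ball_subset_ball' ?_))
      have := Metric.mem_ball.1 hy
      linarith
    calc ∫⁻ y in Metric.ball x R, σ (Metric.ball y r)
        ≤ ∫⁻ y in Metric.ball x R, (σ.restrict (Metric.ball x (2 * R))) (Metric.ball y r) :=
          setLIntegral_mono' Metric.isOpen_ball.measurableSet e1
      _ ≤ ∫⁻ y, (σ.restrict (Metric.ball x (2 * R))) (Metric.ball y r) :=
          setLIntegral_le_lintegral _ _
      _ = (volume.prod (σ.restrict (Metric.ball x (2 * R))))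
            {w : EuclideanSpace ℝ (Fin n) × EuclideanSpace ℝ (Fin n) | dist w.2 w.1 < r} := by
          rw [Measure.prod_apply ho.measurableSet]; rfl
      _ = ∫⁻ z, volume (Metric.ball z r) ∂(σ.restrict (Metric.ball x (2 * R))) := by
          rw [Measure.prod_apply_symm ho.measurableSet]
          refine lintegral_congr fun z => ?_
          congr 1
          ext y
          simp [dist_comm]
      _ = ∫⁻ z, volume (Metric.ball x r) ∂(σ.restrict (Metric.ball x (2 * R))) := by
          refine lintegral_congr fun z => ?_
          rw [Measure.addHaar_ball_center, Measure.addHaar_ball_center volume x]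
      _ = _ := by simp
  have hV0 : volume (Metric.ball (0 : EuclideanSpace ℝ (Fin n)) 1) ≠ 0 :=
    (Metric.measure_ball_pos _ _ one_pos).ne'
  have hVt : volume (Metric.ball (0 : EuclideanSpace ℝ (Fin n)) 1) ≠ ⊤ :=
    measure_ball_lt_top.ne
  have hvr : volume (Metric.ball x r) =
      ENNReal.ofReal ((r / R) ^ (n : ℝ)) * volume (Metric.ball x R) := by
    rw [Measure.addHaar_ball_of_pos _ _ hr, Measure.addHaar_ball_of_pos _ _ hR, ← mul_assoc,
      ← ENNReal.ofReal_mul (by positivity)]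
    congr 2
    rw [Real.rpow_natCast, finrank_euclideanSpace_fin, div_pow]
    field_simp
  have hB0 : volume (Metric.ball x R) ≠ 0 := (Metric.measure_ball_pos _ _ hR).ne'
  have hBt : volume (Metric.ball x R) ≠ ⊤ := measure_ball_lt_top.ne
  calc _ ≤ (volume (Metric.ball x R))⁻¹ * (volume (Metric.ball x r) * σ (Metric.ball x (2 * R))) := by
        gcongr
    _ = ((volume (Metric.ball x R))⁻¹ * volume (Metric.ball x R)) *
        (ENNReal.ofReal ((r / R) ^ (n : ℝ)) * σ (Metric.ball x (2 * R))) := by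
        rw [hvr]; ring
    _ = _ := by rw [ENNReal.inv_mul_cancel hB0 hBt, one_mul]

lemma wolff_aux_jensen {X : Type*} [MeasurableSpace X] (μ : Measure X) (B : Set X)
    (h0 : μ B ≠ 0) (ht : μ B ≠ ⊤) (f : X → ℝ≥0∞) (hf : Measurable f) (q : ℝ)
    (hq0 : 0 < q) (hq1 : q ≤ 1) :
    (μ B)⁻¹ * ∫⁻ y in B, f y ^ q ∂μ ≤ ((μ B)⁻¹ * ∫⁻ y in B, f y ∂μ) ^ q := by
  have h := ENNReal.lintegral_mul_norm_pow_le (μ := μ.restrict B) (f := f) (g := fun _ => 1)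
    hf.aemeasurable aemeasurable_const hq0.le (sub_nonneg.2 hq1) (by ring)
  simp only [ENNReal.one_rpow, mul_one, lintegral_const, one_mul, Measure.restrict_apply_univ] at h
  calc _ ≤ (μ B)⁻¹ * ((∫⁻ y in B, f y ∂μ) ^ q * μ B ^ (1 - q)) := by gcongr
    _ = ((μ B) ^ (-1 : ℝ) * μ B ^ (1 - q)) * (∫⁻ y in B, f y ∂μ) ^ q := by
        rw [ENNReal.rpow_neg_one]; ring
    _ = _ := by
        rw [← ENNReal.rpow_add _ _ h0 ht, ENNReal.mul_rpow_of_nonneg _ _ hq0.le,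
          ← ENNReal.rpow_neg_one (μ B), ← ENNReal.rpow_mul]
        congr 2; ring

lemma wolff_aux_form (S : ℝ≥0∞) (a b q r : ℝ) (ha : 0 ≤ a) (hb : 0 < b) (hr : 0 < r)
    (hq : 0 < q) :
    (ENNReal.ofReal a * S / ENNReal.ofReal b) ^ q / ENNReal.ofReal r
      = S ^ q * ENNReal.ofReal ((a / b) ^ q / r) := by
  rw [ENNReal.ofReal_div_of_pos hr, ← ENNReal.ofReal_rpow_of_nonneg (by positivity) hq.le,
    ENNReal.ofReal_div_of_pos hb, ← mul_div_assoc, ← ENNReal.mul_rpow_of_nonneg _ _ hq.le]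
  congr 2
  simp only [div_eq_mul_inv]; ring

/-- lower bound of the tail -/
lemma wolff_aux_lower {n : ℕ} (q m : ℝ) (hq : 0 < q) (hm : 0 < m)
    (σ : Measure (EuclideanSpace ℝ (Fin n))) (x : EuclideanSpace ℝ (Fin n)) (R : ℝ) (hR : 0 < R) :
    σ (Metric.ball x (2 * R)) ^ q * ENNReal.ofReal ((1 / (4 * R) ^ m) ^ q / 2) ≤
      ∫⁻ r in Set.Ioi R, (σ (Metric.ball x r) / ENNReal.ofReal (r ^ m)) ^ q / ENNReal.ofReal r := by
  calc _ = ∫⁻ r in Set.Ioo (2 * R) (4 * R), (σ (Metric.ball x (2 * R)) /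
            ENNReal.ofReal ((4 * R) ^ m)) ^ q / ENNReal.ofReal (4 * R) := by
        have := wolff_aux_form (σ (Metric.ball x (2 * R))) 1 ((4 * R) ^ m) q (4 * R) zero_le_one
          (by positivity) (by positivity) hq
        rw [ENNReal.ofReal_one, one_mul] at this
        rw [this, setLIntegral_const, Real.volume_Ioo, mul_assoc,
          ← ENNReal.ofReal_mul (by positivity)]
        congr 2
        field_simp; ring
    _ ≤ ∫⁻ r in Set.Ioo (2 * R) (4 * R), (σ (Metric.ball x r) / ENNReal.ofReal (r ^ m)) ^ q
          / ENNReal.ofReal r := by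
        refine setLIntegral_mono' measurableSet_Ioo fun r hr => ?_
        have h0 : 0 < r := by linarith [hr.1]
        have h1 := hr.1.le
        have h2 := hr.2.le
        gcongr
    _ ≤ _ := lintegral_mono_set (fun r hr => by
        have := hr.1
        simp only [Set.mem_Ioi]; linarith)

/-- far part -/
lemma wolff_aux_far {n : ℕ} (q m : ℝ) (hq : 0 < q) (hm : 0 < m)
    (σ : Measure (EuclideanSpace ℝ (Fin n))) [SFinite σ]
    (x y : EuclideanSpace ℝ (Fin n)) (R : ℝ) (hR : 0 < R) (hy : y ∈ Metric.ball x R) :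
    (∫⁻ r in Set.Ioi R, (σ (Metric.ball y r) / ENNReal.ofReal (r ^ m)) ^ q / ENNReal.ofReal r) ≤
    ENNReal.ofReal ((2 ^ m) ^ q) *
      ∫⁻ r in Set.Ioi R, (σ (Metric.ball x r) / ENNReal.ofReal (r ^ m)) ^ q / ENNReal.ofReal r := by
  set g : ℝ → ℝ≥0∞ := fun r =>
    (σ (Metric.ball x r) / ENNReal.ofReal (r ^ m)) ^ q / ENNReal.ofReal r with hg
  have hgm : Measurable g :=
    (wolff_aux_integrand_meas q m σ).of_uncurry_left (f := fun (y : EuclideanSpace ℝ (Fin n)) (r : ℝ) =>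
      (σ (Metric.ball y r) / ENNReal.ofReal (r ^ m)) ^ q / ENNReal.ofReal r) (x := x)
  have key : ∀ r ∈ Set.Ioi R, (σ (Metric.ball y r) / ENNReal.ofReal (r ^ m)) ^ q
      / ENNReal.ofReal r ≤ ENNReal.ofReal ((2 ^ m) ^ q) * (ENNReal.ofReal |2| * g (2 * r)) := by
    intro r hr
    have hr' : R < r := hr
    have h0 : 0 < r := hR.trans hr
    have hsub : σ (Metric.ball y r) ≤ σ (Metric.ball x (2 * r)) := by
      refine measure_mono (Metric.ball_subset_ball' ?_)
      have := Metric.mem_ball.1 hy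
      linarith
    have f1 := wolff_aux_form (σ (Metric.ball x (2 * r))) 1 (r ^ m) q r zero_le_one
          (by positivity) h0 hq
    have f2 := wolff_aux_form (σ (Metric.ball x (2 * r))) 1 ((2 * r) ^ m) q (2 * r) zero_le_one
          (by positivity) (by positivity) hq
    rw [ENNReal.ofReal_one, one_mul] at f1 f2
    calc _ ≤ (σ (Metric.ball x (2 * r)) / ENNReal.ofReal (r ^ m)) ^ q / ENNReal.ofReal r := by
          gcongr
      _ = _ := by
          simp only [hg]
          rw [f1, f2, mul_left_comm (ENNReal.ofReal |2|), ← ENNReal.ofReal_mul (by positivity),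
            mul_left_comm (ENNReal.ofReal ((2 ^ m) ^ q)), ← ENNReal.ofReal_mul (by positivity)]
          congr 2
          rw [abs_of_pos (by norm_num : (0:ℝ) < 2), Real.mul_rpow (by norm_num) h0.le,
            Real.div_rpow zero_le_one (by positivity), Real.div_rpow zero_le_one (by positivity),
            Real.mul_rpow (by positivity) (by positivity)]
          have : 0 < ((2:ℝ) ^ m) ^ q := by positivity
          field_simp
  calc _ ≤ ∫⁻ r in Set.Ioi R, ENNReal.ofReal ((2 ^ m) ^ q) * (ENNReal.ofReal |2| * g (2 * r)) :=
        setLIntegral_mono' measurableSet_Ioi key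
    _ = ENNReal.ofReal ((2 ^ m) ^ q) * ∫⁻ r in Set.Ioi R, (ENNReal.ofReal |2| * g (2 * r)) :=
        lintegral_const_mul' _ _ ENNReal.ofReal_ne_top
    _ = ENNReal.ofReal ((2 ^ m) ^ q) * ∫⁻ r in (fun r => 2 * r) '' Set.Ioi R, g r := by
        rw [lintegral_image_eq_lintegral_abs_deriv_mul (f := fun r : ℝ => 2 * r)
          (f' := fun _ => 2) measurableSet_Ioi
          (fun r _ => by simpa using ((hasDerivAt_id r).const_mul 2).hasDerivWithinAt)
          (fun a _ b _ h => by simpa using h)]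
    _ ≤ _ := by
        gcongr
        rintro _ ⟨r, hr, rfl⟩
        have : R < r := hr
        simp only [Set.mem_Ioi]; linarith

/-- near part, pointwise in the radius -/
lemma wolff_aux_near {n : ℕ} (q m β : ℝ) (hq : 0 < q) (hq1 : q ≤ 1) (hβ : 0 < β)
    (hm : m = n - β)
    (σ : Measure (EuclideanSpace ℝ (Fin n))) [SFinite σ]
    (x : EuclideanSpace ℝ (Fin n)) (R : ℝ) (hR : 0 < R) :
    (volume (Metric.ball x R))⁻¹ * ∫⁻ y in Metric.ball x R, ∫⁻ r in Set.Ioc 0 R,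
      (σ (Metric.ball y r) / ENNReal.ofReal (r ^ m)) ^ q / ENNReal.ofReal r
    ≤ σ (Metric.ball x (2 * R)) ^ q * ENNReal.ofReal ((1 / R ^ m) ^ q / (β * q)) := by
  have hB0 : volume (Metric.ball x R) ≠ 0 := (Metric.measure_ball_pos _ _ hR).ne'
  have hBt : volume (Metric.ball x R) ≠ ⊤ := measure_ball_lt_top.ne
  have hM := wolff_aux_integrand_meas q m σ
  have hpt : ∀ r ∈ Set.Ioc 0 R, (volume (Metric.ball x R))⁻¹ * ∫⁻ y in Metric.ball x R,
      (σ (Metric.ball y r) / ENNReal.ofReal (r ^ m)) ^ q / ENNReal.ofReal r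
      ≤ σ (Metric.ball x (2 * R)) ^ q *
        ENNReal.ofReal ((1 / R ^ (n : ℝ)) ^ q * r ^ (β * q - 1)) := by
    rintro r ⟨h0, hrR⟩
    have hm1 : Measurable (fun y => σ (Metric.ball y r)) :=
      (wolff_aux_meas σ).of_uncurry_right (f := fun (y : EuclideanSpace ℝ (Fin n)) (r : ℝ) =>
        σ (Metric.ball y r)) (y := r)
    calc _ = ((volume (Metric.ball x R))⁻¹ * ∫⁻ y in Metric.ball x R,
          (σ (Metric.ball y r) / ENNReal.ofReal (r ^ m)) ^ q) / ENNReal.ofReal r := by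
          simp only [div_eq_mul_inv (_ ^ q)]
          rw [lintegral_mul_const' _ _ (ENNReal.inv_ne_top.2 (ENNReal.ofReal_pos.2 h0).ne'), div_eq_mul_inv, mul_assoc]
      _ ≤ ((volume (Metric.ball x R))⁻¹ * ∫⁻ y in Metric.ball x R,
          (σ (Metric.ball y r) / ENNReal.ofReal (r ^ m))) ^ q / ENNReal.ofReal r := by
          gcongr
          exact wolff_aux_jensen volume _ hB0 hBt _ (hm1.div measurable_const) q hq hq1
      _ = (((volume (Metric.ball x R))⁻¹ * ∫⁻ y in Metric.ball x R,
          σ (Metric.ball y r)) / ENNReal.ofReal (r ^ m)) ^ q / ENNReal.ofReal r := by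
          simp only [div_eq_mul_inv (σ _)]
          rw [lintegral_mul_const _ hm1, div_eq_mul_inv (_ * _) (ENNReal.ofReal (r ^ m)), mul_assoc]
      _ ≤ (ENNReal.ofReal ((r / R) ^ (n : ℝ)) * σ (Metric.ball x (2 * R))
            / ENNReal.ofReal (r ^ m)) ^ q / ENNReal.ofReal r := by
          have := wolff_aux_fubini σ x R r h0 hrR
          exact ENNReal.div_le_div_right
            (ENNReal.rpow_le_rpow (ENNReal.div_le_div_right this _) hq.le) _
      _ = _ := by
          rw [wolff_aux_form _ _ _ _ _ (by positivity) (by positivity) h0 hq]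
          congr 2
          rw [Real.div_rpow h0.le hR.le, hm, Real.rpow_sub h0, Real.rpow_sub h0, Real.rpow_one,
            Real.rpow_mul h0.le, ← mul_div_assoc, ← Real.mul_rpow (by positivity) (by positivity)]
          congr 2
          have : 0 < r ^ (n : ℝ) := by positivity
          field_simp
  have hint : ∫⁻ r in Set.Ioc 0 R, ENNReal.ofReal ((1 / R ^ (n : ℝ)) ^ q * r ^ (β * q - 1))
      = ENNReal.ofReal ((1 / R ^ m) ^ q / (β * q)) := by
    have hbq : 0 < β * q := by positivity
    have hI : IntervalIntegrable (fun r : ℝ => (1 / R ^ (n : ℝ)) ^ q * r ^ (β * q - 1)) volume 0 R :=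
      (intervalIntegral.intervalIntegrable_rpow' (by linarith)).const_mul _
    rw [← ofReal_integral_eq_lintegral_ofReal
      ((intervalIntegrable_iff_integrableOn_Ioc_of_le hR.le).1 hI)
      ((ae_restrict_iff' measurableSet_Ioc).2 (Filter.Eventually.of_forall fun r hr => by
        have := hr.1
        simp only [Pi.zero_apply]; positivity)),
      ← intervalIntegral.integral_of_le hR.le, intervalIntegral.integral_const_mul,
      integral_rpow (Or.inl (by linarith))]
    congr 1
    rw [sub_add_cancel, Real.zero_rpow hbq.ne', sub_zero, ← mul_div_assoc, Real.rpow_mul hR.le,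
      ← Real.mul_rpow (by positivity) (by positivity), hm, Real.rpow_sub hR]
    congr 2
    have : 0 < R ^ (n : ℝ) := by positivity
    field_simp
  calc _ = (volume (Metric.ball x R))⁻¹ * ∫⁻ r in Set.Ioc 0 R, ∫⁻ y in Metric.ball x R,
      (σ (Metric.ball y r) / ENNReal.ofReal (r ^ m)) ^ q / ENNReal.ofReal r := by
        rw [lintegral_lintegral_swap]
        exact hM.aemeasurable
    _ = ∫⁻ r in Set.Ioc 0 R, (volume (Metric.ball x R))⁻¹ * ∫⁻ y in Metric.ball x R,
      (σ (Metric.ball y r) / ENNReal.ofReal (r ^ m)) ^ q / ENNReal.ofReal r := by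
        rw [lintegral_const_mul' _ _ (ENNReal.inv_ne_top.2 hB0)]
    _ ≤ ∫⁻ r in Set.Ioc 0 R, σ (Metric.ball x (2 * R)) ^ q *
        ENNReal.ofReal ((1 / R ^ (n : ℝ)) ^ q * r ^ (β * q - 1)) :=
        setLIntegral_mono' measurableSet_Ioc hpt
    _ = _ := by rw [lintegral_const_mul _ (by fun_prop), hint]

theorem wolff_average_upper_bound (n : ℕ) (p α : ℝ) (hp : 2 ≤ p)
    (hα0 : 0 < α) (hα : α < n / p) :
    ∃ c : ℝ≥0∞, 0 < c ∧ c ≠ ⊤ ∧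
      ∀ (σ : Measure (EuclideanSpace ℝ (Fin n))), IsLocallyFiniteMeasure σ →
        ∀ (x : EuclideanSpace ℝ (Fin n)) (R : ℝ), 0 < R →
          (volume (Metric.ball x R))⁻¹ * ∫⁻ y in Metric.ball x R, wolff n p α σ y
            ≤ c * wolffTail n p α σ x R := by
  have hp0 : 0 < p := by linarith
  obtain ⟨q, hqdef⟩ : ∃ q, q = 1 / (p - 1) := ⟨_, rfl⟩
  obtain ⟨m, hmdef⟩ : ∃ m, m = (n : ℝ) - α * p := ⟨_, rfl⟩
  have hq : 0 < q := by rw [hqdef]; exact one_div_pos.2 (by linarith)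
  have hq1 : q ≤ 1 := by rw [hqdef, div_le_one (by linarith)]; linarith
  have hm : 0 < m := by
    rw [hmdef]; have := (lt_div_iff₀ hp0).1 hα; linarith
  have hβ : 0 < α * p := by positivity
  refine ⟨ENNReal.ofReal (2 * (4 ^ m) ^ q / (α * p * q)) + ENNReal.ofReal ((2 ^ m) ^ q),
    ?_, by simp, ?_⟩
  · have : 0 < ENNReal.ofReal (((2:ℝ) ^ m) ^ q) := ENNReal.ofReal_pos.2 (by positivity)
    exact this.trans_le le_add_self
  intro σ hσ x R hR
  have hB0 : volume (Metric.ball x R) ≠ 0 := (Metric.measure_ball_pos _ _ hR).ne'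
  have hBt : volume (Metric.ball x R) ≠ ⊤ := measure_ball_lt_top.ne
  have hM := wolff_aux_integrand_meas q m σ
  unfold wolff wolffTail
  rw [← hqdef, ← hmdef]
  set T := ∫⁻ r in Set.Ioi R, (σ (Metric.ball x r) / ENNReal.ofReal (r ^ m)) ^ q
    / ENNReal.ofReal r with hT
  have hsplit : ∀ y ∈ Metric.ball x R,
      (∫⁻ r in Set.Ioi 0, (σ (Metric.ball y r) / ENNReal.ofReal (r ^ m)) ^ q / ENNReal.ofReal r)
      ≤ (∫⁻ r in Set.Ioc 0 R, (σ (Metric.ball y r) / ENNReal.ofReal (r ^ m)) ^ q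
        / ENNReal.ofReal r) + ENNReal.ofReal ((2 ^ m) ^ q) * T := by
    intro y hy
    rw [← Set.Ioc_union_Ioi_eq_Ioi hR.le]
    refine (lintegral_union_le _ _ _).trans ?_
    gcongr
    exact wolff_aux_far q m hq hm σ x y R hR hy
  have hnear := wolff_aux_near q m (α * p) hq hq1 hβ hmdef σ x R hR
  have hlow := wolff_aux_lower q m hq hm σ x R hR
  calc _ ≤ (volume (Metric.ball x R))⁻¹ * ∫⁻ y in Metric.ball x R,
        ((∫⁻ r in Set.Ioc 0 R, (σ (Metric.ball y r) / ENNReal.ofReal (r ^ m)) ^ q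
        / ENNReal.ofReal r) + ENNReal.ofReal ((2 ^ m) ^ q) * T) := by
        gcongr (volume (Metric.ball x R))⁻¹ * ?_
        exact setLIntegral_mono' Metric.isOpen_ball.measurableSet hsplit
    _ = (volume (Metric.ball x R))⁻¹ * (∫⁻ y in Metric.ball x R,
        ∫⁻ r in Set.Ioc 0 R, (σ (Metric.ball y r) / ENNReal.ofReal (r ^ m)) ^ q
        / ENNReal.ofReal r) + ENNReal.ofReal ((2 ^ m) ^ q) * T := by
        rw [lintegral_add_right _ measurable_const, setLIntegral_const, mul_add,
          mul_comm _ (volume _), ← mul_assoc _ (volume _), ENNReal.inv_mul_cancel hB0 hBt, one_mul]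
    _ ≤ ENNReal.ofReal (2 * (4 ^ m) ^ q / (α * p * q)) * T + ENNReal.ofReal ((2 ^ m) ^ q) * T := by
        refine add_le_add ?_ le_rfl
        refine hnear.trans ?_
        refine le_trans (le_of_eq ?_) (mul_le_mul_right hlow _)
        rw [mul_left_comm, ← ENNReal.ofReal_mul (by positivity)]
        congr 2
        rw [Real.mul_rpow (by norm_num) hR.le, Real.div_rpow zero_le_one (by positivity),
          Real.div_rpow zero_le_one (by positivity), Real.mul_rpow (by positivity) (by positivity)]
        have : 0 < ((4:ℝ) ^ m) ^ q := by positivity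
        field_simp
    _ = _ := by rw [add_mul]
end

section
/- Let $1<p<\infty$, $0<q<p-1$, $0<\alpha<n/p$, and $\sigma$ a nonnegative locally finite Borel measure on $\mathbb{R}^n$. Suppose $u\ge 0$ satisfies $u\ge \mathbf{W}_{\alpha,p}(u^q\,d\sigma)$ $\sigma$-a.e., $u\in L^q_{loc}(d\sigma)$, and $u$ is nontrivial ($\int u^q d\sigma>0$). Then for every ball $B$ the least constant $\kappa(B)$ in the inequality $\|\mathbf{W}_{\alpha,p}\nu\|_{L^q(\sigma|_B)}\le \kappa(B)\,\nu(\mathbb{R}^n)^{1/(p-1)}$ (over all finite nonnegative measures $\nu$) satisfies $\kappa(B)\le c(n,p,q,\alpha)\left(\int_B u^q\,d\sigma\right)^{(p-1-q)/(q(p-1))}$. -/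
open MeasureTheory ENNReal

noncomputable def kappa (n : ℕ) (p α q : ℝ) (σ : Measure (EuclideanSpace ℝ (Fin n)))
    (B : Set (EuclideanSpace ℝ (Fin n))) : ℝ≥0∞ :=
  sInf {κ : ℝ≥0∞ | ∀ ν : Measure (EuclideanSpace ℝ (Fin n)), IsFiniteMeasure ν →
    (∫⁻ x in B, wolff n p α ν x ^ q ∂σ) ^ (1 / q) ≤ κ * (ν Set.univ) ^ (1 / (p - 1))}

noncomputable def kappaTail (n : ℕ) (p α q : ℝ) (σ : Measure (EuclideanSpace ℝ (Fin n)))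
    (x : EuclideanSpace ℝ (Fin n)) (t : ℝ) : ℝ≥0∞ :=
  ∫⁻ s in Set.Ioi t,
    (kappa n p α q σ (Metric.ball x s) ^ (q * (p - 1) / (p - 1 - q))
      / ENNReal.ofReal (s ^ ((n : ℝ) - α * p))) ^ (1 / (p - 1)) / ENNReal.ofReal s


lemma kolm_aux {X : Type*} [MeasurableSpace X] (μ : Measure X) (f : X → ℝ≥0∞) (A T : ℝ≥0∞) (s : ℝ)
    (hs : 0 < s) (hT : T ≠ 0) (hT' : T ≠ ⊤) (hA : μ Set.univ ≤ A)
    (h : ∀ k : ℕ, μ {x | 2 ^ k * T < f x} ≤ A * (2 ^ k)⁻¹) :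
    ∫⁻ x, f x ^ s ∂μ ≤ (1 + 2 ^ s * (1 - 2 ^ s * 2⁻¹)⁻¹) * (A * T ^ s) := by
  have hpt : ∀ x, f x ^ s ≤ T ^ s + ∑' k : ℕ,
      (toMeasurable μ {x | 2 ^ k * T < f x}).indicator (fun _ => (2 ^ (k + 1) * T) ^ s) x := by
    intro x
    have hterm : ∀ k : ℕ, (2 : ℝ≥0∞) ^ k * T < f x →
        (toMeasurable μ {x | 2 ^ k * T < f x}).indicator
          (fun _ => ((2 ^ (k + 1) * T) ^ s : ℝ≥0∞)) x
          = (2 ^ (k + 1) * T) ^ s := by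
      intro k hk
      have hk' : x ∈ {x | 2 ^ k * T < f x} := hk
      exact Set.indicator_of_mem (subset_toMeasurable _ _ hk') _
    by_cases hall : ∀ k : ℕ, 2 ^ k * T < f x
    · have : ∑' k : ℕ, (toMeasurable μ {x | 2 ^ k * T < f x}).indicator
          (fun _ => (2 ^ (k + 1) * T) ^ s) x = ⊤ := by
        rw [eq_top_iff]
        calc (⊤ : ℝ≥0∞) = ∑' _ : ℕ, T ^ s :=
              (ENNReal.tsum_const_eq_top_of_ne_zero (by
                rw [Ne, ENNReal.rpow_eq_zero_iff_of_pos hs]; exact hT)).symm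
          _ ≤ _ := by
              refine ENNReal.tsum_le_tsum fun k => ?_
              rw [hterm k (hall k)]
              refine ENNReal.rpow_le_rpow ?_ hs.le
              exact le_mul_of_one_le_left (zero_le) (one_le_pow₀ (by norm_num))
      rw [this]; simp
    · push Not at hall
      classical
      have hm := Nat.find_spec hall
      rcases hk : Nat.find hall with _ | k
      · rw [hk] at hm
        refine le_trans (ENNReal.rpow_le_rpow (by simpa using hm) hs.le) le_self_add
      · have h2 := Nat.find_min hall (m := k) (by omega)
        push Not at h2
        rw [hk] at hm
        refine le_trans ?_ le_add_self
        refine le_trans ?_ (ENNReal.le_tsum k)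
        rw [hterm k h2]
        exact ENNReal.rpow_le_rpow hm hs.le
  calc ∫⁻ x, f x ^ s ∂μ ≤ ∫⁻ x, (T ^ s + ∑' k : ℕ,
      (toMeasurable μ {x | 2 ^ k * T < f x}).indicator (fun _ => (2 ^ (k + 1) * T) ^ s) x) ∂μ :=
        lintegral_mono hpt
    _ = T ^ s * μ Set.univ + ∑' k : ℕ, (2 ^ (k + 1) * T) ^ s * μ {x | 2 ^ k * T < f x} := by
        rw [lintegral_add_left measurable_const, lintegral_const, lintegral_tsum]
        · congr 1
          refine tsum_congr fun k => ?_
          rw [lintegral_indicator_const (measurableSet_toMeasurable _ _), measure_toMeasurable]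
        · intro k
          exact (measurable_const.indicator (measurableSet_toMeasurable _ _)).aemeasurable
    _ ≤ A * T ^ s + ∑' k : ℕ, 2 ^ s * (A * T ^ s) * (2 ^ s * 2⁻¹) ^ k := by
        rw [mul_comm (T ^ s)]
        refine add_le_add (mul_le_mul_left hA _) (ENNReal.tsum_le_tsum fun k => ?_)
        calc (2 ^ (k + 1) * T) ^ s * μ {x | 2 ^ k * T < f x}
            ≤ (2 ^ (k + 1) * T) ^ s * (A * (2 ^ k)⁻¹) := by gcongr; exact h k
          _ = 2 ^ s * (A * T ^ s) * (2 ^ s * 2⁻¹) ^ k := by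
            have e : ((2 : ℝ≥0∞) ^ (k + 1)) ^ s = 2 ^ s * (2 ^ s) ^ k := by
              rw [pow_succ', ENNReal.mul_rpow_of_nonneg _ _ hs.le]
              congr 1
              rw [← ENNReal.rpow_natCast, ← ENNReal.rpow_natCast, ← ENNReal.rpow_mul,
                ← ENNReal.rpow_mul, mul_comm]
            rw [ENNReal.mul_rpow_of_nonneg _ _ hs.le, e, mul_pow, ENNReal.inv_pow]
            ring
    _ = _ := by
        rw [ENNReal.tsum_mul_left, ENNReal.tsum_geometric]
        ring

lemma weak_type (n : ℕ) : ∃ N : ℕ, ∀ (ν ω : Measure (EuclideanSpace ℝ (Fin n))) (t : ℝ≥0∞),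
    t ≠ 0 → t ≠ ⊤ →
    ω {x | t < ⨆ r : {r : ℝ // 0 < r}, ν (Metric.ball x r) / ω (Metric.ball x r)}
      ≤ N * ν Set.univ / t := by
  obtain ⟨N, τ, hτ, hN⟩ :=
    HasBesicovitchCovering.no_satelliteConfig (α := EuclideanSpace ℝ (Fin n))
  refine ⟨N, fun ν ω t ht ht' => ?_⟩
  let E : ℕ → Set (EuclideanSpace ℝ (Fin n)) := fun k =>
    {x | ∃ r : ℝ, 0 < r ∧ r ≤ k ∧ ω (Metric.ball x r) ≤ ν (Metric.ball x r) / t}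
  have hmono : Monotone E := by
    intro a b hab x hx
    obtain ⟨r, h1, h2, h3⟩ := hx
    exact ⟨r, h1, h2.trans (by exact_mod_cast hab), h3⟩
  have hsub : {x | t < ⨆ r : {r : ℝ // 0 < r}, ν (Metric.ball x r) / ω (Metric.ball x r)}
      ⊆ ⋃ k, E k := by
    intro x hx
    obtain ⟨⟨r, hr⟩, h⟩ := lt_iSup_iff.1 (show t < _ from hx)
    obtain ⟨k, hk⟩ := exists_nat_ge r
    refine Set.mem_iUnion.2 ⟨k, r, hr, hk, ?_⟩
    rw [ENNReal.le_div_iff_mul_le (Or.inl ht) (Or.inl ht'), mul_comm]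
    exact (ENNReal.mul_lt_of_lt_div h).le
  refine (measure_mono hsub).trans ?_
  rw [hmono.measure_iUnion]
  refine iSup_le fun k => ?_
  choose! r hr0 hrk hr using fun x (hx : x ∈ E k) => hx
  let Q : Besicovitch.BallPackage (E k) (EuclideanSpace ℝ (Fin n)) :=
    { c := fun x => x
      r := fun x => r x
      rpos := fun x => hr0 x x.2
      r_bound := k
      r_le := fun x => hrk x x.2 }
  obtain ⟨S, hS, hcov⟩ := Besicovitch.exist_disjoint_covering_families hτ hN Q
  have hcount : ∀ i, (S i).Countable := fun i =>
    (hS i).countable_of_nonempty_interior fun j _ =>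
      ⟨Q.c j, Metric.ball_subset_interior_closedBall (Metric.mem_ball_self (Q.rpos j))⟩
  calc ω (E k) ≤ ω (⋃ i : Fin N, ⋃ j ∈ S i, Metric.ball (Q.c j) (Q.r j)) := by
        refine measure_mono fun x hx => hcov ⟨⟨x, hx⟩, rfl⟩
    _ ≤ ∑ i : Fin N, ω (⋃ j ∈ S i, Metric.ball (Q.c j) (Q.r j)) := measure_iUnion_fintype_le _ _
    _ ≤ ∑ i : Fin N, ν Set.univ / t := by
        refine Finset.sum_le_sum fun i _ => ?_
        have := (hcount i).to_subtype
        calc ω (⋃ j ∈ S i, Metric.ball (Q.c j) (Q.r j))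
            ≤ ∑' j : S i, ω (Metric.ball (Q.c j) (Q.r j)) := measure_biUnion_le _ (hcount i) _
          _ ≤ ∑' j : S i, ν (Metric.ball (Q.c j) (Q.r j)) / t :=
              ENNReal.tsum_le_tsum fun j => hr _ j.1.2
          _ = (∑' j : S i, ν (Metric.ball (Q.c j) (Q.r j))) / t := by
              simp_rw [div_eq_mul_inv]; rw [ENNReal.tsum_mul_right]
          _ ≤ ν Set.univ / t := by
              gcongr
              refine (tsum_meas_le_meas_iUnion_of_disjoint ν (fun j => measurableSet_ball)
                ?_).trans (measure_mono (Set.subset_univ _))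
              intro a b hab
              exact (hS i a.2 b.2 (fun h => hab (Subtype.ext h))).mono
                Metric.ball_subset_closedBall Metric.ball_subset_closedBall
    _ = _ := by simp [mul_div_assoc]

lemma wolff_integrand_meas (n : ℕ) (p α : ℝ) (ω : Measure (EuclideanSpace ℝ (Fin n)))
    (x : EuclideanSpace ℝ (Fin n)) : Measurable fun r : ℝ =>
    (ω (Metric.ball x r) / ENNReal.ofReal (r ^ ((n : ℝ) - α * p))) ^ (1 / (p - 1))
      / ENNReal.ofReal r := by
  have : Measurable fun r : ℝ => ω (Metric.ball x r) :=
    Monotone.measurable fun a b hab => measure_mono (Metric.ball_subset_ball hab)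
  exact (((this.div (ENNReal.measurable_ofReal.comp (measurable_id.pow_const _))).pow_const _).div
    ENNReal.measurable_ofReal)

lemma wolff_pos (n : ℕ) (p α : ℝ) (hp : 1 < p) (ω : Measure (EuclideanSpace ℝ (Fin n)))
    (x : EuclideanSpace ℝ (Fin n)) (hω : ω Set.univ ≠ 0) : wolff n p α ω x ≠ 0 := by
  intro h
  unfold wolff wolffTail at h
  rw [lintegral_eq_zero_iff (wolff_integrand_meas n p α ω x),
    Filter.EventuallyEq, ae_restrict_iff' measurableSet_Ioi] at h
  apply hω
  have hU : ⋃ k : ℕ, Metric.ball x (k : ℝ) = Set.univ := Metric.iUnion_ball_nat x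
  rw [← hU, measure_iUnion_null_iff]
  intro k
  by_contra hk
  have h0 : volume (Set.Ioi (k : ℝ)) = 0 := by
    refine measure_mono_null ?_ h
    intro r hr
    have hr' : (k : ℝ) < r := hr
    have hr0 : 0 < r := lt_of_le_of_lt (Nat.cast_nonneg k) hr'
    simp only [Set.mem_compl_iff, Set.mem_ofPred_eq, Classical.not_imp]
    refine ⟨hr0, ?_⟩
    simp only [Pi.zero_apply]
    have hb : ω (Metric.ball x r) ≠ 0 := fun hz =>
      hk (measure_mono_null (Metric.ball_subset_ball hr'.le) hz)
    have he : 0 < 1 / (p - 1) := by apply one_div_pos.2; linarith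
    rw [ENNReal.div_eq_zero_iff, not_or, ENNReal.rpow_eq_zero_iff_of_pos he,
      ENNReal.div_eq_zero_iff]
    simp [hb]
  simp at h0

lemma wolff_le (n : ℕ) (p α : ℝ) (hp : 1 < p) (ν ω : Measure (EuclideanSpace ℝ (Fin n)))
    (x : EuclideanSpace ℝ (Fin n)) (h0 : ∀ r : ℝ, 0 < r → ω (Metric.ball x r) ≠ 0)
    (h1 : ∀ r : ℝ, 0 < r → ω (Metric.ball x r) ≠ ⊤) :
    wolff n p α ν x ≤ (⨆ r : {r : ℝ // 0 < r}, ν (Metric.ball x r) / ω (Metric.ball x r))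
      ^ (1 / (p - 1)) * wolff n p α ω x := by
  have he : 0 < 1 / (p - 1) := by apply one_div_pos.2; linarith
  unfold wolff wolffTail
  rw [← lintegral_const_mul _ (wolff_integrand_meas n p α ω x)]
  refine setLIntegral_mono' measurableSet_Ioi fun r hr => ?_
  rw [← mul_div_assoc, ← ENNReal.mul_rpow_of_nonneg _ _ he.le, ← mul_div_assoc]
  gcongr
  rw [← ENNReal.div_le_iff (h0 r hr) (h1 r hr)]
  exact le_iSup (fun r : {r : ℝ // 0 < r} => ν (Metric.ball x r) / ω (Metric.ball x r)) ⟨r, hr⟩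

lemma main_est (n : ℕ) (p q α : ℝ) (hp : 1 < p) (hq0 : 0 < q) (N : ℕ)
    (hN : ∀ (ν ω : Measure (EuclideanSpace ℝ (Fin n))) (t : ℝ≥0∞),
    t ≠ 0 → t ≠ ⊤ →
    ω {x | t < ⨆ r : {r : ℝ // 0 < r}, ν (Metric.ball x r) / ω (Metric.ball x r)}
      ≤ N * ν Set.univ / t)
    (σ : Measure (EuclideanSpace ℝ (Fin n)))
    (u : EuclideanSpace ℝ (Fin n) → ℝ≥0∞) (hu : Measurable u)
    (hfin : ∀ (x : EuclideanSpace ℝ (Fin n)) (R : ℝ), 0 < R →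
            ∫⁻ y in Metric.ball x R, u y ^ q ∂σ ≠ ⊤)
    (hpos : 0 < ∫⁻ y, u y ^ q ∂σ)
    (hsup : ∀ᵐ x ∂σ, wolff n p α (σ.withDensity fun y => u y ^ q) x ≤ u x)
    (x : EuclideanSpace ℝ (Fin n)) (R : ℝ) (hR : 0 < R)
    (ν : Measure (EuclideanSpace ℝ (Fin n))) [IsFiniteMeasure ν] :
    ∫⁻ y in Metric.ball x R, wolff n p α ν y ^ q ∂σ ≤
      (1 + 2 ^ (q / (p - 1)) * (1 - 2 ^ (q / (p - 1)) * 2⁻¹)⁻¹) *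
        ((∫⁻ y in Metric.ball x R, u y ^ q ∂σ) *
        ((N + 1) * ν Set.univ / ∫⁻ y in Metric.ball x R, u y ^ q ∂σ) ^ (q / (p - 1))) := by
  set s := q / (p - 1) with hs
  have hp1 : 0 < p - 1 := by linarith
  have hs0 : 0 < s := div_pos hq0 hp1
  have huq : Measurable fun y => u y ^ q := hu.pow_const q
  set ω := σ.withDensity fun y => u y ^ q with hω
  have hωball : ∀ y r, ω (Metric.ball y r) = ∫⁻ y in Metric.ball y r, u y ^ q ∂σ := fun y r =>
    withDensity_apply _ measurableSet_ball
  have hωuniv : ω Set.univ ≠ 0 := by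
    rw [hω, withDensity_apply _ MeasurableSet.univ, Measure.restrict_univ]; exact hpos.ne'
  have hupos : ∀ᵐ y ∂σ, u y ≠ 0 := by
    filter_upwards [hsup] with y hy h0
    rw [h0] at hy
    exact wolff_pos n p α hp ω y hωuniv (le_antisymm hy (zero_le))
  have hac : σ ≪ ω := by
    refine withDensity_absolutelyContinuous' huq.aemeasurable ?_
    filter_upwards [hupos] with y hy h0
    exact hy ((ENNReal.rpow_eq_zero_iff_of_pos hq0).1 h0)
  have hsupp : ∀ᵐ y ∂σ, ∀ r : ℝ, 0 < r → ω (Metric.ball y r) ≠ 0 := by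
    have h1 : ∀ᵐ y ∂ω, y ∈ ω.support := Measure.support_mem_ae
    filter_upwards [hac.ae_le h1] with y hy r hr
    exact ((Measure.mem_support_iff_forall y).1 hy _ (Metric.ball_mem_nhds y hr)).ne'
  have hufin : ∀ᵐ y ∂(σ.restrict (Metric.ball x R)), u y ^ q < ⊤ :=
    ae_lt_top huq (hfin x R hR)
  set M : EuclideanSpace ℝ (Fin n) → ℝ≥0∞ := fun y =>
    ⨆ r : {r : ℝ // 0 < r}, ν (Metric.ball y r) / ω (Metric.ball y r) with hM
  have hstep : ∫⁻ y in Metric.ball x R, wolff n p α ν y ^ q ∂σ ≤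
      ∫⁻ y in Metric.ball x R, M y ^ s ∂ω := by
    rw [hω, setLIntegral_withDensity_eq_setLIntegral_mul_non_measurable σ huq _
      measurableSet_ball hufin]
    refine lintegral_mono_ae (ae_restrict_of_ae ?_)
    filter_upwards [hsupp, hsup] with y h1 h2
    have h3 := wolff_le n p α hp ν ω y h1 (fun r hr => by rw [hωball]; exact hfin y r hr)
    calc wolff n p α ν y ^ q ≤ (M y ^ (1 / (p - 1)) * u y) ^ q := by
          refine ENNReal.rpow_le_rpow (h3.trans ?_) hq0.le
          gcongr
      _ = _ := by
          rw [ENNReal.mul_rpow_of_nonneg _ _ hq0.le, ← ENNReal.rpow_mul, mul_comm, hs]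
          simp only [Pi.mul_apply]
          have e : 1 / (p - 1) * q = q / (p - 1) := by ring
          rw [e]
  refine hstep.trans ?_
  rw [← hωball]
  have hAtop : ω (Metric.ball x R) ≠ ⊤ := by rw [hωball]; exact hfin x R hR
  by_cases hA : ω (Metric.ball x R) = 0
  · rw [setLIntegral_measure_zero _ _ hA]; exact zero_le
  by_cases hν : ν = 0
  · have : ∀ y, M y = 0 := fun y => by simp [hM, hν]
    simp [this, hs0]
  have hνu : ν Set.univ ≠ 0 := fun h => hν (Measure.measure_univ_eq_zero.1 h)
  have hT0 : (N + 1) * ν Set.univ / ω (Metric.ball x R) ≠ 0 := by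
    rw [Ne, ENNReal.div_eq_zero_iff]; simp [hνu, hAtop]
  have hTt : (N + 1) * ν Set.univ / ω (Metric.ball x R) ≠ ⊤ := by
    refine ENNReal.div_ne_top (ENNReal.mul_ne_top ?_ (measure_ne_top _ _)) hA
    simp
  refine kolm_aux _ M _ _ s hs0 hT0 hTt (by simp) fun k => ?_
  refine (Measure.restrict_apply_le _ _).trans ?_
  have h2 : (2 : ℝ≥0∞) ^ k ≠ 0 := by simp
  have h2t : (2 : ℝ≥0∞) ^ k ≠ ⊤ := by simp
  refine (hN ν ω _ (mul_ne_zero h2 hT0) (ENNReal.mul_ne_top h2t hTt)).trans ?_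
  rw [ENNReal.div_le_iff (mul_ne_zero h2 hT0) (ENNReal.mul_ne_top h2t hTt)]
  calc (N : ℝ≥0∞) * ν Set.univ ≤ (N + 1) * ν Set.univ := by gcongr; exact le_self_add
    _ = ω (Metric.ball x R) * ((N + 1) * ν Set.univ / ω (Metric.ball x R)) * ((2 ^ k)⁻¹ * 2 ^ k) := by
      rw [ENNReal.inv_mul_cancel h2 h2t, mul_one, ENNReal.mul_div_cancel hA hAtop]
    _ = _ := by ring

theorem kappa_upper_bound_of_supersolution (n : ℕ) (p q α : ℝ) (hp : 1 < p)
    (hq0 : 0 < q) (hq : q < p - 1) (hα0 : 0 < α) (hα : α < n / p) :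
    ∃ c : ℝ≥0∞, 0 < c ∧ c ≠ ⊤ ∧
      ∀ (σ : Measure (EuclideanSpace ℝ (Fin n))), IsLocallyFiniteMeasure σ →
        ∀ u : EuclideanSpace ℝ (Fin n) → ℝ≥0∞, Measurable u →
          (∀ (x : EuclideanSpace ℝ (Fin n)) (R : ℝ), 0 < R →
            ∫⁻ y in Metric.ball x R, u y ^ q ∂σ ≠ ⊤) →
          0 < ∫⁻ y, u y ^ q ∂σ →
          (∀ᵐ x ∂σ, wolff n p α (σ.withDensity fun y => u y ^ q) x ≤ u x) →
          ∀ (x : EuclideanSpace ℝ (Fin n)) (R : ℝ), 0 < R →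
            kappa n p α q σ (Metric.ball x R)
              ≤ c * (∫⁻ y in Metric.ball x R, u y ^ q ∂σ) ^ ((p - 1 - q) / (q * (p - 1))) := by
  have hp1 : 0 < p - 1 := by linarith
  obtain ⟨N, hN⟩ := weak_type n
  have hs0 : 0 < q / (p - 1) := div_pos hq0 hp1
  have hs1 : q / (p - 1) < 1 := (div_lt_one hp1).2 hq
  set s := q / (p - 1) with hs
  set K : ℝ≥0∞ := 1 + 2 ^ s * (1 - 2 ^ s * 2⁻¹)⁻¹ with hK
  have hKt : K ≠ ⊤ := by
    have h1 : (2 : ℝ≥0∞) ^ s * 2⁻¹ < 1 := by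
      rw [← div_eq_mul_inv, ENNReal.div_lt_iff (by simp) (by simp), one_mul]
      calc (2 : ℝ≥0∞) ^ s < 2 ^ (1 : ℝ) := ENNReal.rpow_lt_rpow_of_exponent_lt (by norm_num) (by simp) hs1
        _ = 2 := by simp
    refine ENNReal.add_ne_top.2 ⟨by simp, ENNReal.mul_ne_top ?_ ?_⟩
    · exact ENNReal.rpow_ne_top_of_nonneg hs0.le (by simp)
    · rw [Ne, ENNReal.inv_eq_top]
      exact (tsub_pos_of_lt h1).ne'
  have hK0 : K ≠ 0 := by
    intro h; rw [hK] at h; simp at h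
  refine ⟨K ^ (1 / q) * (N + 1) ^ (1 / (p - 1)), ?_, ?_, ?_⟩
  · rw [pos_iff_ne_zero]
    refine mul_ne_zero ?_ ?_
    · rw [Ne, ENNReal.rpow_eq_zero_iff_of_pos (by positivity)]; exact hK0
    · rw [Ne, ENNReal.rpow_eq_zero_iff_of_pos (by positivity)]; simp
  · exact ENNReal.mul_ne_top (ENNReal.rpow_ne_top_of_nonneg (by positivity) hKt)
      (ENNReal.rpow_ne_top_of_nonneg (by positivity) (by simp))
  intro σ _ u hu hfin hpos hsup x R hR
  refine sInf_le fun ν hν => ?_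
  have hmain := main_est n p q α hp hq0 N hN σ u hu hfin hpos hsup x R hR ν
  rw [← hs, ← hK] at hmain
  set A := ∫⁻ y in Metric.ball x R, u y ^ q ∂σ with hA
  have hAt : A ≠ ⊤ := hfin x R hR
  have hq1 : 0 ≤ 1 / q := by positivity
  refine (ENNReal.rpow_le_rpow hmain hq1).trans ?_
  by_cases hA0 : A = 0
  · rw [hA0, zero_mul, mul_zero, ENNReal.zero_rpow_of_pos (by positivity)]
    exact zero_le
  have e1 : s * (1 / q) = 1 / (p - 1) := by rw [hs]; field_simp
  have e2 : (p - 1 - q) / (q * (p - 1)) = 1 / q + -(1 / (p - 1)) := by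
    field_simp
    ring
  rw [ENNReal.mul_rpow_of_nonneg _ _ hq1, ENNReal.mul_rpow_of_nonneg _ _ hq1,
    ← ENNReal.rpow_mul, e1, e2, ENNReal.rpow_add _ _ hA0 hAt,
    ENNReal.div_rpow_of_nonneg _ _ (by positivity),
    ENNReal.mul_rpow_of_nonneg _ _ (by positivity : 0 ≤ 1 / (p - 1)), ENNReal.rpow_neg,
    div_eq_mul_inv (_ * _) (A ^ _)]
  exact le_of_eq (by ring)
end

section
/- Let $1<p<\infty$, $0<q<p-1$, $0<\alpha<n/p$, and $\sigma$ a nonnegative locally finite Borel measure on $\mathbb{R}^n$ such that there exists $\kappa>0$ with $\|\mathbf{W}_{\alpha,p}\nu\|_{L^q(d\sigma)}\le\kappa\,\nu(\mathbb{R}^n)^{1/(p-1)}$ for all finite nonnegative measures $\nu$. Then $\int_{\mathbb{R}^n}(\mathbf{W}_{\alpha,p}\sigma)^{q(p-1)/(p-1-q)}\,d\sigma \le C\,\kappa^{q(p-1)/(p-1-q)}$ with $C$ depending only on $n,p,q,\alpha$. -/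
open MeasureTheory ENNReal

/-- The integrand of the Wolff potential. -/
noncomputable def wolffKer (n : ℕ) (p α : ℝ)
    (σ : Measure (EuclideanSpace ℝ (Fin n))) (x : EuclideanSpace ℝ (Fin n)) (r : ℝ) : ℝ≥0∞ :=
  (σ (Metric.ball x r) / ENNReal.ofReal (r ^ ((n : ℝ) - α * p))) ^ (1 / (p - 1))
      / ENNReal.ofReal r

theorem wolffTail_eq (n : ℕ) (p α : ℝ)
    (σ : Measure (EuclideanSpace ℝ (Fin n))) (x : EuclideanSpace ℝ (Fin n)) (R : ℝ) :
    wolffTail n p α σ x R = ∫⁻ r in Set.Ioi R, wolffKer n p α σ x r := rfl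

theorem measurable_wolffKer_prod (n : ℕ) (p α : ℝ)
    (σ : Measure (EuclideanSpace ℝ (Fin n))) [SFinite σ] :
    Measurable (fun z : EuclideanSpace ℝ (Fin n) × ℝ => wolffKer n p α σ z.1 z.2) := by
  have h1 : Measurable (fun z : EuclideanSpace ℝ (Fin n) × ℝ => σ (Metric.ball z.1 z.2)) := by
    have hS : MeasurableSet {w : (EuclideanSpace ℝ (Fin n) × ℝ) × EuclideanSpace ℝ (Fin n) |
        dist w.2 w.1.1 < w.1.2} := by
      apply IsOpen.measurableSet
      exact isOpen_lt (by fun_prop) (by fun_prop)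
    exact measurable_measure_prodMk_left hS
  have h2 : Measurable (fun z : EuclideanSpace ℝ (Fin n) × ℝ =>
      ENNReal.ofReal (z.2 ^ ((n : ℝ) - α * p))) :=
    (measurable_snd.pow_const _).ennreal_ofReal
  exact ((h1.div h2).pow_const _).div measurable_snd.ennreal_ofReal

theorem measurable_wolffKer (n : ℕ) (p α : ℝ)
    (σ : Measure (EuclideanSpace ℝ (Fin n))) [SFinite σ] (x : EuclideanSpace ℝ (Fin n)) :
    Measurable (wolffKer n p α σ x) := by
  have hmono : Monotone (fun r : ℝ => σ (Metric.ball x r)) := fun a b hab =>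
    measure_mono (Metric.ball_subset_ball hab)
  have h1 : Measurable (fun r : ℝ => σ (Metric.ball x r)) := hmono.measurable
  have h2 : Measurable (fun r : ℝ => ENNReal.ofReal (r ^ ((n : ℝ) - α * p))) :=
    (measurable_id.pow_const _).ennreal_ofReal
  exact ((h1.div h2).pow_const _).div measurable_id.ennreal_ofReal

theorem measurable_wolff (n : ℕ) (p α : ℝ)
    (σ : Measure (EuclideanSpace ℝ (Fin n))) [SFinite σ] :
    Measurable (wolff n p α σ) :=
  Measurable.lintegral_prod_right' (ν := volume.restrict (Set.Ioi (0:ℝ)))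
    (measurable_wolffKer_prod n p α σ)

theorem wolffKer_mono {n : ℕ} {p α : ℝ} (hp : 1 < p)
    {μ ν : Measure (EuclideanSpace ℝ (Fin n))} {x y : EuclideanSpace ℝ (Fin n)} {r : ℝ}
    (h : μ (Metric.ball x r) ≤ ν (Metric.ball y r)) :
    wolffKer n p α μ x r ≤ wolffKer n p α ν y r := by
  have : 0 ≤ 1 / (p - 1) := by have := sub_pos.2 hp; positivity
  unfold wolffKer
  gcongr

/-- The layer-cake type bound. -/
theorem lintegral_tail_bound (g : ℝ → ℝ≥0∞) (hg : Measurable g) (k : ℝ≥0∞) (hk : k ≠ ⊤) (β : ℝ)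
    (hβ : 0 ≤ β) :
    (min (∫⁻ r in Set.Ioi (0:ℝ), g r) k / 2) ^ (1 + β) ≤
      ∫⁻ t in Set.Ioi (0:ℝ), (min (∫⁻ r in Set.Ioi t, g r) k) ^ β * g t := by
  set G : ℝ → ℝ≥0∞ := fun t => ∫⁻ r in Set.Ioi t, g r with hG
  set M := min (G 0) k with hM
  have hMtop : M ≠ ⊤ := ne_top_of_le_ne_top hk (min_le_right _ _)
  have hanti : Antitone G := fun a b hab =>
    lintegral_mono_set (Set.Ioi_subset_Ioi hab)
  have hGm : Measurable G := hanti.measurable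
  set S : Set ℝ := {t | G t < M / 2} with hS
  have hSm : MeasurableSet S := measurableSet_lt hGm measurable_const
  -- the integral over `S ∩ (0,∞)` is at most `M / 2`
  have hSle : ∫⁻ t in S ∩ Set.Ioi 0, g t ≤ M / 2 := by
    by_cases hne : (S ∩ Set.Ioi 0).Nonempty
    · set T := sInf (S ∩ Set.Ioi 0) with hT
      have hbdd : BddBelow (S ∩ Set.Ioi (0:ℝ)) := ⟨0, fun t ht => le_of_lt ht.2⟩
      obtain ⟨u, hu, hu', huS⟩ := exists_seq_tendsto_sInf hne hbdd
      have hsub : (S ∩ Set.Ioi 0 : Set ℝ) ⊆ {T} ∪ ⋃ m, Set.Ioi (u m) := by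
        intro t ht
        rcases (csInf_le hbdd ht).eq_or_lt with h | h
        · left; exact h.symm
        · right
          obtain ⟨m, hm⟩ := (hu'.eventually (gt_mem_nhds h)).exists
          exact Set.mem_iUnion.2 ⟨m, hm⟩
      calc ∫⁻ t in S ∩ Set.Ioi 0, g t ≤ ∫⁻ t in {T} ∪ ⋃ m, Set.Ioi (u m), g t :=
            lintegral_mono_set hsub
        _ ≤ (∫⁻ t in {T}, g t) + ∫⁻ t in ⋃ m, Set.Ioi (u m), g t := lintegral_union_le _ _ _
        _ = ∫⁻ t in ⋃ m, Set.Ioi (u m), g t := by simp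
        _ = ⨆ m, ∫⁻ t in Set.Ioi (u m), g t := by
            rw [setLIntegral_iUnion_of_directed]
            exact (Monotone.directed_le fun a b hab => Set.Ioi_subset_Ioi (hu hab))
        _ ≤ M / 2 := iSup_le fun m => le_of_lt (huS m).1
    · rw [Set.not_nonempty_iff_eq_empty.1 hne]; simp
  have hsplit : G 0 = (∫⁻ t in S ∩ Set.Ioi 0, g t) + ∫⁻ t in Set.Ioi 0 \ S, g t := by
    rw [Set.inter_comm]
    exact (lintegral_inter_add_sdiff g (Set.Ioi 0) hSm).symm
  have hlow : M / 2 ≤ ∫⁻ t in Set.Ioi 0 \ S, g t := by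
    have h1 : M / 2 + M / 2 ≤ M / 2 + ∫⁻ t in Set.Ioi 0 \ S, g t := by
      rw [ENNReal.add_halves]
      calc M ≤ G 0 := min_le_left _ _
        _ ≤ _ := by rw [hsplit]; gcongr
    exact (ENNReal.add_le_add_iff_left (ENNReal.div_ne_top hMtop (by simp))).1 h1
  calc (M / 2) ^ (1 + β) ≤ (M / 2) ^ β * (M / 2) := by
        rw [add_comm, ENNReal.rpow_add_of_nonneg _ _ hβ zero_le_one, ENNReal.rpow_one]
    _ ≤ (M / 2) ^ β * ∫⁻ t in Set.Ioi 0 \ S, g t := by gcongr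
    _ = ∫⁻ t in Set.Ioi 0 \ S, (M / 2) ^ β * g t := (lintegral_const_mul _ hg).symm
    _ ≤ ∫⁻ t in Set.Ioi 0 \ S, (min (G t) k) ^ β * g t := by
        apply setLIntegral_mono' (measurableSet_Ioi.diff hSm)
        intro t ht
        have h1 : M / 2 ≤ G t := not_lt.1 ht.2
        have h2 : M / 2 ≤ k := ENNReal.half_le_self.trans (min_le_right _ _)
        gcongr
        exact le_min h1 h2
    _ ≤ _ := lintegral_mono_set Set.sdiff_subset

/-- The constant in the comparison of tails. -/
noncomputable def wolffConst (n : ℕ) (p α : ℝ) : ℝ≥0∞ :=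
  (1 / ENNReal.ofReal (2 ^ ((n : ℝ) - α * p))) ^ (1 / (p - 1)) / 2

theorem wolffConst_pos {n : ℕ} {p α : ℝ} (hp : 1 < p) : wolffConst n p α ≠ 0 := by
  have h1 : 0 < 1 / (p - 1) := by have := sub_pos.2 hp; positivity
  unfold wolffConst
  simp [ENNReal.rpow_eq_zero_iff]
  intro h; linarith

theorem wolffConst_le {n : ℕ} {p α : ℝ} (hp : 1 < p) (hd : 0 ≤ (n : ℝ) - α * p) :
    wolffConst n p α ≤ 1 := by
  have h1 : 0 < 1 / (p - 1) := by have := sub_pos.2 hp; positivity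
  unfold wolffConst
  refine ENNReal.half_le_self.trans ?_
  apply ENNReal.rpow_le_one _ h1.le
  rw [one_div]
  apply ENNReal.inv_le_one.2
  rw [ENNReal.one_le_ofReal]
  exact Real.one_le_rpow (by norm_num) hd

theorem wolffKer_shift {n : ℕ} {p α : ℝ} (hp : 1 < p) (hd : 0 ≤ (n : ℝ) - α * p)
    (σ : Measure (EuclideanSpace ℝ (Fin n))) (x y : EuclideanSpace ℝ (Fin n)) (t u : ℝ)
    (ht : 0 < t) (hu : t < u) (hy : y ∈ Metric.ball x t) :
    wolffConst n p α * wolffKer n p α σ x u ≤ wolffKer n p α σ y (u + t) := by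
  have hs : 0 < 1 / (p - 1) := by have := sub_pos.2 hp; positivity
  have hu0 : 0 < u := ht.trans hu
  have hball : Metric.ball x u ⊆ Metric.ball y (u + t) := by
    intro z hz
    have := dist_triangle z x y
    rw [Metric.mem_ball] at *
    rw [dist_comm] at hy
    linarith
  unfold wolffConst wolffKer
  have hden : ENNReal.ofReal ((u + t) ^ ((n : ℝ) - α * p)) ≤
      ENNReal.ofReal (2 ^ ((n : ℝ) - α * p)) * ENNReal.ofReal (u ^ ((n : ℝ) - α * p)) := by
    rw [← ENNReal.ofReal_mul (by positivity), ← Real.mul_rpow (by norm_num) hu0.le]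
    apply ENNReal.ofReal_le_ofReal
    apply Real.rpow_le_rpow (by positivity) (by linarith) hd
  have hden2 : ENNReal.ofReal (u + t) ≤ 2 * ENNReal.ofReal u := by
    rw [← ENNReal.ofReal_ofNat, ← ENNReal.ofReal_mul (by norm_num)]
    apply ENNReal.ofReal_le_ofReal; linarith
  set a := ENNReal.ofReal (2 ^ ((n : ℝ) - α * p)) with ha
  set b := ENNReal.ofReal (u ^ ((n : ℝ) - α * p)) with hb
  have ha0 : a ≠ 0 := by rw [ha]; simp; positivity
  have hb0 : b ≠ 0 := by rw [hb]; simp; positivity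
  have hu00 : ENNReal.ofReal u ≠ 0 := by simp; exact hu0
  calc (1 / a) ^ (1 / (p - 1)) / 2 * ((σ (Metric.ball x u) / b) ^ (1 / (p - 1)) / ENNReal.ofReal u)
      = (σ (Metric.ball x u) / (a * b)) ^ (1 / (p - 1)) / (2 * ENNReal.ofReal u) := by
        have e1 : σ (Metric.ball x u) / (a * b) = (1 / a) * (σ (Metric.ball x u) / b) := by
          simp only [div_eq_mul_inv, one_mul]
          rw [ENNReal.mul_inv (Or.inl ha0) (Or.inr hb0)]
          ring
        rw [e1, ENNReal.mul_rpow_of_nonneg _ _ hs.le]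
        simp only [div_eq_mul_inv]
        rw [ENNReal.mul_inv (a := 2) (Or.inl (by simp)) (Or.inl (by simp))]
        ring
    _ ≤ _ := by gcongr

theorem wolff_ge_tail {n : ℕ} {p α : ℝ} (hp : 1 < p) (hd : 0 ≤ (n : ℝ) - α * p)
    (σ : Measure (EuclideanSpace ℝ (Fin n))) [SFinite σ] (x y : EuclideanSpace ℝ (Fin n)) (t : ℝ)
    (ht : 0 < t) (hy : y ∈ Metric.ball x t) :
    wolffConst n p α * wolffTail n p α σ x t ≤ wolff n p α σ y := by
  unfold wolff
  rw [wolffTail_eq, wolffTail_eq, ← lintegral_const_mul _ (measurable_wolffKer n p α σ x)]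
  calc ∫⁻ u in Set.Ioi t, wolffConst n p α * wolffKer n p α σ x u
      ≤ ∫⁻ u in Set.Ioi t, wolffKer n p α σ y (u + t) :=
        setLIntegral_mono' measurableSet_Ioi fun u hu =>
          wolffKer_shift hp hd σ x y t u ht hu hy
    _ = ∫⁻ u, (Set.Ioi (t + t)).indicator (wolffKer n p α σ y) (u + t) := by
        rw [← lintegral_indicator measurableSet_Ioi]
        congr 1; ext u
        simp [Set.indicator]
    _ = ∫⁻ u, (Set.Ioi (t + t)).indicator (wolffKer n p α σ y) u :=
        lintegral_add_right_eq_self _ t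
    _ = ∫⁻ u in Set.Ioi (t + t), wolffKer n p α σ y u := lintegral_indicator measurableSet_Ioi _
    _ ≤ _ := lintegral_mono_set (Set.Ioi_subset_Ioi (by linarith))

theorem wolff_iterate {n : ℕ} {p q α : ℝ} (hp : 1 < p) (hq0 : 0 < q) (hq : q < p - 1)
    (hd : 0 ≤ (n : ℝ) - α * p)
    (σ : Measure (EuclideanSpace ℝ (Fin n))) [SFinite σ] (k : ℝ≥0∞) (hk : k ≠ ⊤)
    (x : EuclideanSpace ℝ (Fin n)) :
    wolffConst n p α ^ (q / (p - 1 - q)) * (min (wolff n p α σ x) k / 2) ^ (1 + q / (p - 1 - q)) ≤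
      wolff n p α (σ.withDensity fun y =>
        (min (wolff n p α σ y) k) ^ (q * (p - 1) / (p - 1 - q))) x := by
  have hp1 : 0 < p - 1 := sub_pos.2 hp
  have hpq : 0 < p - 1 - q := sub_pos.2 hq
  have hβ : 0 < q / (p - 1 - q) := by positivity
  have hγ : 0 < q * (p - 1) / (p - 1 - q) := by positivity
  have hs : 0 < 1 / (p - 1) := by positivity
  set β := q / (p - 1 - q) with hβdef
  set γ := q * (p - 1) / (p - 1 - q) with hγdef
  have hγβ : γ * (1 / (p - 1)) = β := by rw [hγdef, hβdef]; field_simp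
  set c := wolffConst n p α with hc
  have hc1 : c ≤ 1 := wolffConst_le hp hd
  set ν := σ.withDensity fun y => (min (wolff n p α σ y) k) ^ γ with hν
  have hgm := measurable_wolffKer n p α σ x
  have hb := lintegral_tail_bound (wolffKer n p α σ x) hgm k hk β hβ.le
  have hanti : Antitone (fun t : ℝ => ∫⁻ r in Set.Ioi t, wolffKer n p α σ x r) := fun a b hab =>
    lintegral_mono_set (Set.Ioi_subset_Ioi hab)
  have hm := hanti.measurable
  calc c ^ β * (min (wolff n p α σ x) k / 2) ^ (1 + β)
      ≤ c ^ β * ∫⁻ t in Set.Ioi (0:ℝ),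
        (min (∫⁻ r in Set.Ioi t, wolffKer n p α σ x r) k) ^ β * wolffKer n p α σ x t := by
        gcongr; exact hb
    _ = ∫⁻ t in Set.Ioi (0:ℝ), c ^ β *
        ((min (∫⁻ r in Set.Ioi t, wolffKer n p α σ x r) k) ^ β * wolffKer n p α σ x t) := by
        rw [lintegral_const_mul]
        exact ((hm.min measurable_const).pow_const β).mul hgm
    _ ≤ ∫⁻ t in Set.Ioi (0:ℝ), wolffKer n p α ν x t := by
        apply setLIntegral_mono' measurableSet_Ioi
        intro t ht
        set m := min (∫⁻ r in Set.Ioi t, wolffKer n p α σ x r) k with hmdef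
        have h1 : (c * m) ^ γ * σ (Metric.ball x t) ≤ ν (Metric.ball x t) := by
          rw [hν, withDensity_apply _ measurableSet_ball, ← setLIntegral_const]
          apply setLIntegral_mono' measurableSet_ball
          intro y hy
          have h2 := wolff_ge_tail hp hd σ x y t ht hy
          rw [wolffTail_eq] at h2
          have h3 : c * m ≤ min (wolff n p α σ y) k := by
            apply le_min
            · exact le_trans (by gcongr; exact min_le_left _ _) h2
            · calc c * m ≤ 1 * k := by gcongr; exact min_le_right _ _
                _ = k := one_mul k
          exact ENNReal.rpow_le_rpow h3 hγ.le
        calc c ^ β * (m ^ β * wolffKer n p α σ x t)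
            = ((c * m) ^ γ * σ (Metric.ball x t) / ENNReal.ofReal (t ^ ((n : ℝ) - α * p)))
              ^ (1 / (p - 1)) / ENNReal.ofReal t := by
              unfold wolffKer
              rw [mul_div_assoc, ENNReal.mul_rpow_of_nonneg _ _ hs.le, ← ENNReal.rpow_mul, hγβ,
                ENNReal.mul_rpow_of_nonneg _ _ hβ.le]
              simp only [div_eq_mul_inv]
              ring
          _ ≤ wolffKer n p α ν x t := by
              unfold wolffKer
              gcongr
    _ = wolff n p α ν x := rfl

/-- The final constant. -/
noncomputable def wolffD (n : ℕ) (p q α : ℝ) : ℝ≥0∞ :=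
  wolffConst n p α ^ (q / (p - 1 - q)) * (1 / 2) ^ (1 + q / (p - 1 - q))

theorem wolffD_ne_zero {n : ℕ} {p q α : ℝ} (hp : 1 < p) (hq0 : 0 < q) (hq : q < p - 1) :
    wolffD n p q α ≠ 0 := by
  have hpq : 0 < p - 1 - q := sub_pos.2 hq
  have hβ : 0 < q / (p - 1 - q) := by positivity
  unfold wolffD
  apply mul_ne_zero
  · rw [Ne, ENNReal.rpow_eq_zero_iff_of_pos hβ]; exact wolffConst_pos hp
  · rw [Ne, ENNReal.rpow_eq_zero_iff_of_pos (by positivity)]; simp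

theorem wolffD_ne_top {n : ℕ} {p q α : ℝ} (hp : 1 < p) (hq0 : 0 < q) (hq : q < p - 1)
    (hd : 0 ≤ (n : ℝ) - α * p) :
    wolffD n p q α ≠ ⊤ := by
  have hpq : 0 < p - 1 - q := sub_pos.2 hq
  have hβ : 0 < q / (p - 1 - q) := by positivity
  unfold wolffD
  apply ENNReal.mul_ne_top
  · exact ENNReal.rpow_ne_top_of_nonneg hβ.le (ne_top_of_le_ne_top one_ne_top (wolffConst_le hp hd))
  · exact ENNReal.rpow_ne_top_of_nonneg (by positivity) (by simp)

theorem wolff_energy_truncated {n : ℕ} {p q α : ℝ} (hp : 1 < p) (hq0 : 0 < q) (hq : q < p - 1)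
    (hd : 0 ≤ (n : ℝ) - α * p)
    (σ : Measure (EuclideanSpace ℝ (Fin n))) [IsFiniteMeasure σ] (k : ℝ≥0∞) (hk : k ≠ ⊤)
    (κ : ℝ≥0∞)
    (H : ∀ ν : Measure (EuclideanSpace ℝ (Fin n)), IsFiniteMeasure ν →
            (∫⁻ x, wolff n p α ν x ^ q ∂σ) ^ (1 / q) ≤ κ * (ν Set.univ) ^ (1 / (p - 1))) :
    ∫⁻ x, (min (wolff n p α σ x) k) ^ (q * (p - 1) / (p - 1 - q)) ∂σ ≤
      ((wolffD n p q α)⁻¹) ^ (q * (p - 1) / (p - 1 - q)) *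
        κ ^ (q * (p - 1) / (p - 1 - q)) := by
  have hp1 : 0 < p - 1 := sub_pos.2 hp
  have hpq : 0 < p - 1 - q := sub_pos.2 hq
  have hβ : 0 < q / (p - 1 - q) := by positivity
  have hγ : 0 < q * (p - 1) / (p - 1 - q) := by positivity
  have hit := wolff_iterate hp hq0 hq hd σ k hk
  have hD0 := wolffD_ne_zero (n := n) (α := α) hp hq0 hq
  have hDt := wolffD_ne_top hp hq0 hq hd
  set γ := q * (p - 1) / (p - 1 - q) with hγdef
  set β := q / (p - 1 - q) with hβdef
  set D := wolffD n p q α with hD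
  set ν := σ.withDensity fun y => (min (wolff n p α σ y) k) ^ γ with hν
  set E := ∫⁻ x, (min (wolff n p α σ x) k) ^ γ ∂σ with hE
  have hEtop : E ≠ ⊤ := by
    apply ne_top_of_le_ne_top (b := k ^ γ * σ Set.univ)
    · exact ENNReal.mul_ne_top (ENNReal.rpow_ne_top_of_nonneg hγ.le hk) (measure_ne_top _ _)
    · rw [← lintegral_const]
      exact lintegral_mono fun x => ENNReal.rpow_le_rpow (min_le_right _ _) hγ.le
  have hνu : ν Set.univ = E := by rw [hν, withDensity_apply _ MeasurableSet.univ]; simp [hE]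
  have hνf : IsFiniteMeasure ν := ⟨by rw [hνu]; exact hEtop.lt_top⟩
  have h1 := H ν hνf
  rw [hνu] at h1
  have hγβ : (1 + β) * q = γ := by rw [hγdef, hβdef]; field_simp; ring
  have hmeas : Measurable fun x => (min (wolff n p α σ x) k) ^ γ :=
    ((measurable_wolff n p α σ).min measurable_const).pow_const γ
  have h2 : D ^ q * E ≤ ∫⁻ x, wolff n p α ν x ^ q ∂σ := by
    rw [hE, ← lintegral_const_mul _ hmeas]
    apply lintegral_mono
    intro x
    refine le_trans (le_of_eq ?_) (ENNReal.rpow_le_rpow (hit x) hq0.le)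
    beta_reduce
    have e : wolffConst n p α ^ β * (min (wolff n p α σ x) k / 2) ^ (1 + β) =
        D * (min (wolff n p α σ x) k) ^ (1 + β) := by
      have hD' : D = wolffConst n p α ^ β * (1 / 2) ^ (1 + β) := rfl
      rw [hD', div_eq_mul_one_div (min (wolff n p α σ x) k) 2,
        ENNReal.mul_rpow_of_nonneg _ _ (by positivity)]
      ring
    rw [e, ENNReal.mul_rpow_of_nonneg _ _ hq0.le, ← ENNReal.rpow_mul, hγβ]
  have h3 : D * E ^ (1 / q) ≤ κ * E ^ (1 / (p - 1)) := by
    refine le_trans ?_ h1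
    refine le_trans (le_of_eq ?_) (ENNReal.rpow_le_rpow h2 (by positivity))
    rw [ENNReal.mul_rpow_of_nonneg _ _ (by positivity), ← ENNReal.rpow_mul,
      mul_one_div_cancel hq0.ne', ENNReal.rpow_one]
  by_cases hE0 : E = 0
  · rw [hE0]; exact zero_le
  have h4 : D * E ^ (1 / γ) ≤ κ := by
    have e : 1 / q = 1 / γ + 1 / (p - 1) := by rw [hγdef]; field_simp; ring
    rw [e, ENNReal.rpow_add _ _ hE0 hEtop, ← mul_assoc] at h3
    refine (ENNReal.mul_le_mul_iff_left ?_ ?_).1 h3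
    · rw [Ne, ENNReal.rpow_eq_zero_iff_of_pos (by positivity)]; exact hE0
    · exact ENNReal.rpow_ne_top_of_nonneg (by positivity) hEtop
  have h5 : E ^ (1 / γ) ≤ D⁻¹ * κ := by
    calc E ^ (1 / γ) = D⁻¹ * (D * E ^ (1 / γ)) := by
          rw [← mul_assoc, ENNReal.inv_mul_cancel hD0 hDt, one_mul]
      _ ≤ _ := by gcongr
  calc E = (E ^ (1 / γ)) ^ γ := by
        rw [← ENNReal.rpow_mul, one_div_mul_cancel hγ.ne', ENNReal.rpow_one]
    _ ≤ (D⁻¹ * κ) ^ γ := ENNReal.rpow_le_rpow h5 hγ.le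
    _ = _ := ENNReal.mul_rpow_of_nonneg _ _ hγ.le

theorem wolff_energy_bound_of_trace_inequality (n : ℕ) (p q α : ℝ) (hp : 1 < p)
    (hq0 : 0 < q) (hq : q < p - 1) (hα0 : 0 < α) (hα : α < n / p) :
    ∃ C : ℝ≥0∞, 0 < C ∧ C ≠ ⊤ ∧
      ∀ (σ : Measure (EuclideanSpace ℝ (Fin n))), IsLocallyFiniteMeasure σ →
        ∀ κ : ℝ≥0∞,
          (∀ ν : Measure (EuclideanSpace ℝ (Fin n)), IsFiniteMeasure ν →
            (∫⁻ x, wolff n p α ν x ^ q ∂σ) ^ (1 / q) ≤ κ * (ν Set.univ) ^ (1 / (p - 1))) →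
          ∫⁻ x, wolff n p α σ x ^ (q * (p - 1) / (p - 1 - q)) ∂σ
            ≤ C * κ ^ (q * (p - 1) / (p - 1 - q)) := by
  have hp0 : 0 < p := by linarith
  have hp1 : 0 < p - 1 := sub_pos.2 hp
  have hpq : 0 < p - 1 - q := sub_pos.2 hq
  have hγ : 0 < q * (p - 1) / (p - 1 - q) := by positivity
  have hd : 0 ≤ (n : ℝ) - α * p := by
    rw [lt_div_iff₀ hp0] at hα; linarith
  have hD0 := wolffD_ne_zero (n := n) (α := α) hp hq0 hq
  have hDt := wolffD_ne_top hp hq0 hq hd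
  refine ⟨((wolffD n p q α)⁻¹) ^ (q * (p - 1) / (p - 1 - q)), ?_, ?_, ?_⟩
  · exact ENNReal.rpow_pos (ENNReal.inv_pos.2 hDt) (ENNReal.inv_ne_top.2 hD0)
  · exact ENNReal.rpow_ne_top_of_nonneg hγ.le (ENNReal.inv_ne_top.2 hD0)
  intro σ hσ κ H
  set γ := q * (p - 1) / (p - 1 - q) with hγdef
  -- truncations
  set B : ℕ → Set (EuclideanSpace ℝ (Fin n)) := fun m => Metric.ball 0 m with hB
  have hBm : ∀ m, MeasurableSet (B m) := fun m => measurableSet_ball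
  have hBmono : Monotone B := fun a b hab => Metric.ball_subset_ball (by exact_mod_cast hab)
  set τ : ℕ → Measure (EuclideanSpace ℝ (Fin n)) := fun m => σ.restrict (B m) with hτ
  have hτf : ∀ m, IsFiniteMeasure (τ m) := fun m =>
    ⟨by simp only [hτ, Measure.restrict_apply_univ]; exact measure_ball_lt_top⟩
  have hbound : ∀ m : ℕ, ∫⁻ x, (min (wolff n p α (τ m) x) m) ^ γ ∂(τ m) ≤
      ((wolffD n p q α)⁻¹) ^ γ * κ ^ γ := by
    intro m
    apply wolff_energy_truncated hp hq0 hq hd (τ m) m (by simp) κ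
    intro ν hν
    refine le_trans (ENNReal.rpow_le_rpow ?_ (by positivity)) (H ν hν)
    exact lintegral_mono' Measure.restrict_le_self le_rfl
  have hτmono : Monotone τ := fun a b hab => Measure.restrict_mono (hBmono hab) le_rfl
  have hWmono : ∀ x, Monotone fun m => wolff n p α (τ m) x := by
    intro x a b hab
    exact lintegral_mono fun r => wolffKer_mono hp (hτmono hab _)
  have hW : ∀ x, wolff n p α σ x = ⨆ m, wolff n p α (τ m) x := by
    intro x
    have : ∀ r, wolffKer n p α σ x r = ⨆ m, wolffKer n p α (τ m) x r := by
      intro r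
      apply le_antisymm
      · obtain ⟨m, hm⟩ := exists_nat_ge (r + dist x 0)
        refine le_iSup_of_le m (wolffKer_mono hp ?_)
        simp only [hτ]
        rw [Measure.restrict_apply measurableSet_ball, Set.inter_eq_left.2]
        exact Metric.ball_subset_ball' hm
      · exact iSup_le fun m => wolffKer_mono hp (Measure.restrict_le_self _)
    change ∫⁻ r in Set.Ioi 0, wolffKer n p α σ x r = _
    simp_rw [this]
    exact lintegral_iSup (fun m => measurable_wolffKer n p α (τ m) x)
      (fun a b hab r => wolffKer_mono hp (hτmono hab _))
  set F : ℕ → EuclideanSpace ℝ (Fin n) → ℝ≥0∞ := fun m =>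
    (B m).indicator fun x => (min (wolff n p α (τ m) x) m) ^ γ with hF
  have hFm : ∀ m, Measurable (F m) := fun m =>
    (((measurable_wolff n p α (τ m)).min measurable_const).pow_const γ).indicator (hBm m)
  have hFmono : Monotone F := by
    intro a b hab x
    simp only [hF]
    by_cases hx : x ∈ B a
    · rw [Set.indicator_of_mem hx, Set.indicator_of_mem (hBmono hab hx)]
      apply ENNReal.rpow_le_rpow _ hγ.le
      exact min_le_min (hWmono x hab) (by exact_mod_cast hab)
    · rw [Set.indicator_of_notMem hx]; exact zero_le
  have hFsup : ∀ x, wolff n p α σ x ^ γ ≤ ⨆ m, F m x := by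
    intro x
    rw [← ENNReal.le_rpow_inv_iff hγ]
    apply le_of_forall_lt
    intro a ha
    rw [hW x, lt_iSup_iff] at ha
    obtain ⟨m, hm⟩ := ha
    obtain ⟨m1, hm1⟩ := ENNReal.exists_nat_gt hm.ne_top
    obtain ⟨m2, hm2⟩ := exists_nat_gt (dist x 0)
    set N := max m (max m1 m2) with hN
    have hxN : x ∈ B N := by
      simp only [hB, Metric.mem_ball]
      refine hm2.trans_le ?_
      exact_mod_cast (le_max_right m1 m2).trans (le_max_right _ _)
    have h1 : a < min (wolff n p α (τ N) x) N := by
      apply lt_min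
      · exact hm.trans_le (hWmono x (le_max_left _ _))
      · refine hm1.trans_le ?_
        exact_mod_cast (le_max_left m1 m2).trans (le_max_right _ _)
    refine h1.trans_le ?_
    rw [ENNReal.le_rpow_inv_iff hγ]
    refine le_iSup_of_le N ?_
    simp only [hF]
    rw [Set.indicator_of_mem hxN]
  calc ∫⁻ x, wolff n p α σ x ^ γ ∂σ ≤ ∫⁻ x, ⨆ m, F m x ∂σ := lintegral_mono hFsup
    _ = ⨆ m, ∫⁻ x, F m x ∂σ := lintegral_iSup hFm hFmono
    _ ≤ _ := by
      apply iSup_le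
      intro m
      simp only [hF]
      rw [lintegral_indicator (hBm m)]
      exact hbound m
end
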